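/- arXiv:1006.3378 — 4 statements merged into one kernel-verified Lean document; each statement's English description precedes it below -/
import Mathlib

section
/- Let p : ℕ → ℝ with 0 ≤ p(n) ≤ 1 for all n. If p(n)·n → 0 as n → ∞, then asymptotically almost surely a random graph Γ ∈ G(n, p(n)) contains no empty square. -/
open Finset Filter Topology

attribute [local instance] Classical.propDecidable

/-- The Erdős–Rényi weight of a graph `Γ` on `n` vertices with edge probability `p`:
`p^{E_Γ} (1-p)^{C(n,2) - E_Γ}`. -/
noncomputable def gnpWeight (n : ℕ) (p : ℝ) (Γ : SimpleGraph (Fin n)) : ℝ :=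
  p ^ Γ.edgeSet.ncard * (1 - p) ^ (n.choose 2 - Γ.edgeSet.ncard)

/-- The probability of the event `A` under the Erdős–Rényi model `G(n,p)`. -/
noncomputable def gnpProb (n : ℕ) (p : ℝ) (A : SimpleGraph (Fin n) → Prop) : ℝ :=
  ∑ Γ : SimpleGraph (Fin n), if A Γ then gnpWeight n p Γ else 0

/-- The expectation of a random variable `X` under the Erdős–Rényi model `G(n,p)`. -/
noncomputable def gnpExp (n : ℕ) (p : ℝ) (X : SimpleGraph (Fin n) → ℝ) : ℝ :=
  ∑ Γ : SimpleGraph (Fin n), gnpWeight n p Γ * X Γ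

/-- The ordered 4-tuple of distinct vertices `(v₁, v₂, w₁, w₂)` forms an empty square in `Γ`
with diagonal pairs `{v₁,v₂}` and `{w₁,w₂}`: the four sides are edges, the diagonals are not. -/
def IsEmptySquare {V : Type*} (Γ : SimpleGraph V) (v₁ v₂ w₁ w₂ : V) : Prop :=
  v₁ ≠ v₂ ∧ v₁ ≠ w₁ ∧ v₁ ≠ w₂ ∧ v₂ ≠ w₁ ∧ v₂ ≠ w₂ ∧ w₁ ≠ w₂ ∧
    Γ.Adj v₁ w₁ ∧ Γ.Adj v₁ w₂ ∧ Γ.Adj v₂ w₁ ∧ Γ.Adj v₂ w₂ ∧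
    ¬ Γ.Adj v₁ v₂ ∧ ¬ Γ.Adj w₁ w₂

/-- Binomial weights of the subsets of `E` that contain `S` add up to `p ^ #S`. -/
theorem sum_supersets_pow_card_mul_one_sub_pow {α : Type*} [DecidableEq α] (p : ℝ) {S E : Finset α}
    (hS : S ⊆ E) :
    ∑ t ∈ E.powerset with S ⊆ t, p ^ #t * (1 - p) ^ (#E - #t) = p ^ #S := by
  have hfilter : (E.powerset.filter fun t => S ⊆ t) = (E \ S).powerset.image (S ∪ ·) := by
    rw [← Finset.Icc_eq_image_powerset hS]
    ext t
    simp [and_comm]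
  have hdisj : ∀ t ∈ (E \ S).powerset, Disjoint S t := fun t ht =>
    Finset.disjoint_sdiff.mono_right (Finset.mem_powerset.1 ht)
  rw [hfilter, Finset.sum_image]
  · calc ∑ t ∈ (E \ S).powerset, p ^ #(S ∪ t) * (1 - p) ^ (#E - #(S ∪ t))
        = ∑ t ∈ (E \ S).powerset, p ^ #S * (p ^ #t * (1 - p) ^ (#(E \ S) - #t)) := by
          refine Finset.sum_congr rfl fun t ht => ?_
          rw [Finset.card_union_of_disjoint (hdisj t ht), Finset.card_sdiff_of_subset hS,
            pow_add, Nat.sub_sub, mul_assoc]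
      _ = p ^ #S := by
          rw [← Finset.mul_sum, Finset.sum_pow_mul_eq_add_pow]
          simp
  · intro t ht u hu htu
    have := congrArg (· \ S) htu
    simpa [Finset.union_sdiff_cancel_left (hdisj t ht),
      Finset.union_sdiff_cancel_left (hdisj u hu)] using this

/-- The probability that all edges in a given set are present. -/
theorem gnpProb_subset_edgeSet (n : ℕ) (p : ℝ) {S : Finset (Sym2 (Fin n))}
    (hS : ∀ e ∈ S, ¬ e.IsDiag) :
    gnpProb n p (fun Γ => (S : Set (Sym2 (Fin n))) ⊆ Γ.edgeSet) = p ^ #S := by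
  have hE : #(⊤ : SimpleGraph (Fin n)).edgeFinset = n.choose 2 := by
    simpa using SimpleGraph.card_edgeFinset_top_eq_card_choose_two (V := Fin n)
  have hSE : S ⊆ (⊤ : SimpleGraph (Fin n)).edgeFinset := fun e he => by
    simpa using hS e he
  rw [← sum_supersets_pow_card_mul_one_sub_pow p hSE, gnpProb, ← Finset.sum_filter]
  refine Finset.sum_bij' (fun Γ _ => Γ.edgeFinset)
    (fun t _ => SimpleGraph.fromEdgeSet (t : Set (Sym2 (Fin n)))) ?_ ?_ ?_ ?_ ?_
  · intro Γ hΓ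
    have h := (Finset.mem_filter.1 hΓ).2
    refine Finset.mem_filter.2 ⟨Finset.mem_powerset.2 ?_, fun e he => ?_⟩
    · exact SimpleGraph.edgeFinset_mono le_top
    · exact SimpleGraph.mem_edgeFinset.2 (h he)
  · intro t ht
    refine Finset.mem_filter.2 ⟨Finset.mem_univ _, fun e he => ?_⟩
    rw [SimpleGraph.edgeSet_fromEdgeSet]
    exact ⟨(Finset.mem_filter.1 ht).2 he, hS e he⟩
  · intro Γ _
    simp
  · intro t ht
    have h := Finset.mem_powerset.1 (Finset.mem_filter.1 ht).1
    suffices hΓ : ∀ Γ : SimpleGraph (Fin n), Γ = SimpleGraph.fromEdgeSet (t : Set (Sym2 (Fin n))) →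
        Γ.edgeFinset = t from hΓ _ rfl
    intro Γ hΓ
    ext e
    rw [SimpleGraph.mem_edgeFinset, hΓ, SimpleGraph.edgeSet_fromEdgeSet]
    exact ⟨fun he => he.1, fun he => ⟨he, by simpa using h he⟩⟩
  · intro Γ _
    rw [gnpWeight, hE, ← SimpleGraph.coe_edgeFinset, Set.ncard_coe_finset]

theorem gnpWeight_nonneg (n : ℕ) {p : ℝ} (h₀ : 0 ≤ p) (h₁ : p ≤ 1) (Γ : SimpleGraph (Fin n)) :
    0 ≤ gnpWeight n p Γ :=
  mul_nonneg (pow_nonneg h₀ _) (pow_nonneg (sub_nonneg.2 h₁) _)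

theorem gnpProb_nonneg (n : ℕ) {p : ℝ} (h₀ : 0 ≤ p) (h₁ : p ≤ 1)
    (A : SimpleGraph (Fin n) → Prop) : 0 ≤ gnpProb n p A :=
  Finset.sum_nonneg fun Γ _ => ite_nonneg (gnpWeight_nonneg n h₀ h₁ Γ) le_rfl

theorem gnpProb_mono (n : ℕ) {p : ℝ} (h₀ : 0 ≤ p) (h₁ : p ≤ 1)
    {A B : SimpleGraph (Fin n) → Prop} (hAB : ∀ Γ, A Γ → B Γ) :
    gnpProb n p A ≤ gnpProb n p B := by
  refine Finset.sum_le_sum fun Γ _ => ?_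
  have := gnpWeight_nonneg n h₀ h₁ Γ
  have := hAB Γ
  split_ifs <;> simp_all

theorem gnpProb_add_gnpProb_not (n : ℕ) (p : ℝ) (A : SimpleGraph (Fin n) → Prop) :
    gnpProb n p A + gnpProb n p (fun Γ => ¬ A Γ) = 1 := by
  have htotal := gnpProb_subset_edgeSet n p (S := ∅) (by simp)
  simp only [Finset.coe_empty, Set.empty_subset, Finset.card_empty, pow_zero] at htotal
  rw [← htotal, gnpProb, gnpProb, gnpProb, ← Finset.sum_add_distrib]
  refine Finset.sum_congr rfl fun Γ _ => ?_
  by_cases h : A Γ <;> simp [h]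

/-- The union bound. -/
theorem gnpProb_exists_le {ι : Type*} [Fintype ι] (n : ℕ) {p : ℝ} (h₀ : 0 ≤ p) (h₁ : p ≤ 1)
    (A : ι → SimpleGraph (Fin n) → Prop) :
    gnpProb n p (fun Γ => ∃ i, A i Γ) ≤ ∑ i, gnpProb n p (A i) := by
  simp only [gnpProb]
  rw [Finset.sum_comm]
  refine Finset.sum_le_sum fun Γ _ => ?_
  have hnonneg : ∀ i ∈ Finset.univ, 0 ≤ if A i Γ then gnpWeight n p Γ else 0 :=
    fun i _ => ite_nonneg (gnpWeight_nonneg n h₀ h₁ Γ) le_rfl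
  split_ifs with h
  · obtain ⟨i, hi⟩ := h
    exact (if_pos hi).ge.trans (Finset.single_le_sum hnonneg (Finset.mem_univ i))
  · exact Finset.sum_nonneg hnonneg

theorem gnpProb_isEmptySquare_le (n : ℕ) {p : ℝ} (h₀ : 0 ≤ p) (h₁ : p ≤ 1)
    (v₁ v₂ w₁ w₂ : Fin n) :
    gnpProb n p (fun Γ => IsEmptySquare Γ v₁ v₂ w₁ w₂) ≤ p ^ 4 := by
  by_cases hd : v₁ ≠ v₂ ∧ v₁ ≠ w₁ ∧ v₁ ≠ w₂ ∧ v₂ ≠ w₁ ∧ v₂ ≠ w₂ ∧ w₁ ≠ w₂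
  · obtain ⟨hv, h11, h12, h21, h22, hw⟩ := hd
    have hcard : #({s(v₁, w₁), s(v₁, w₂), s(v₂, w₁), s(v₂, w₂)} : Finset (Sym2 (Fin n))) = 4 := by
      rw [Finset.card_insert_of_notMem, Finset.card_insert_of_notMem,
        Finset.card_insert_of_notMem, Finset.card_singleton]
      all_goals simp [hv, h11, h12, h22, hw, h11.symm, h21.symm, h22.symm]
    rw [← hcard, ← gnpProb_subset_edgeSet n p (by simp [h11, h12, h21, h22])]
    refine gnpProb_mono n h₀ h₁ fun Γ hΓ => ?_
    obtain ⟨-, -, -, -, -, -, a11, a12, a21, a22, -⟩ := hΓ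
    simp [Set.insert_subset_iff, a11, a12, a21, a22]
  · have hzero : gnpProb n p (fun Γ => IsEmptySquare Γ v₁ v₂ w₁ w₂) = 0 := by
      refine Finset.sum_eq_zero fun Γ _ => if_neg fun hΓ => hd ?_
      obtain ⟨hv, h11, h12, h21, h22, hw, -⟩ := hΓ
      exact ⟨hv, h11, h12, h21, h22, hw⟩
    rw [hzero]
    positivity

theorem gnpProb_exists_isEmptySquare_le (n : ℕ) {p : ℝ} (h₀ : 0 ≤ p) (h₁ : p ≤ 1) :
    gnpProb n p (fun Γ => ∃ x : Fin n × Fin n × Fin n × Fin n,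
      IsEmptySquare Γ x.1 x.2.1 x.2.2.1 x.2.2.2) ≤ (p * n) ^ 4 := by
  refine (gnpProb_exists_le n h₀ h₁ _).trans ?_
  refine (Finset.sum_le_sum fun x _ => gnpProb_isEmptySquare_le n h₀ h₁ _ _ _ _).trans_eq ?_
  simp only [Finset.sum_const, Finset.card_univ, Fintype.card_prod, Fintype.card_fin, nsmul_eq_mul]
  push_cast
  ring

/-- If `p(n)·n → 0`, then a.a.s. `Γ ∈ G(n, p(n))` contains no empty square. -/
theorem gnp_aas_no_empty_square (p : ℕ → ℝ) (hp : ∀ n, 0 ≤ p n ∧ p n ≤ 1)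
    (h : Tendsto (fun n : ℕ => p n * (n : ℝ)) atTop (nhds 0)) :
    Tendsto (fun n : ℕ =>
      gnpProb n (p n) (fun Γ => ∀ v₁ v₂ w₁ w₂ : Fin n, ¬ IsEmptySquare Γ v₁ v₂ w₁ w₂))
      atTop (nhds 1) := by
  have hbad : ∀ n, gnpProb n (p n)
        (fun Γ => ¬ ∀ v₁ v₂ w₁ w₂ : Fin n, ¬ IsEmptySquare Γ v₁ v₂ w₁ w₂) ≤ (p n * n) ^ 4 := by
    intro n
    refine (gnpProb_mono n (hp n).1 (hp n).2 fun Γ hΓ => ?_).trans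
      (gnpProb_exists_isEmptySquare_le n (hp n).1 (hp n).2)
    push Not at hΓ
    obtain ⟨v₁, v₂, w₁, w₂, hsq⟩ := hΓ
    exact ⟨(v₁, v₂, w₁, w₂), hsq⟩
  have hlower : Tendsto (fun n : ℕ => 1 - (p n * (n : ℝ)) ^ 4) atTop (nhds 1) := by
    simpa using (h.pow 4).const_sub 1
  refine tendsto_of_tendsto_of_tendsto_of_le_of_le hlower tendsto_const_nhds
    (fun n => ?_) (fun n => ?_)
  · linarith [hbad n, gnpProb_add_gnpProb_not n (p n)
      fun Γ => ∀ v₁ v₂ w₁ w₂ : Fin n, ¬ IsEmptySquare Γ v₁ v₂ w₁ w₂]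
  · linarith [gnpProb_nonneg n (hp n).1 (hp n).2
        fun Γ => ¬ ∀ v₁ v₂ w₁ w₂ : Fin n, ¬ IsEmptySquare Γ v₁ v₂ w₁ w₂,
      gnpProb_add_gnpProb_not n (p n)
        fun Γ => ∀ v₁ v₂ w₁ w₂ : Fin n, ¬ IsEmptySquare Γ v₁ v₂ w₁ w₂]
end

section
/- Fix n ≥ 2 and 0 ≤ p ≤ 1. Let X : G(n,p) → ℤ be the random variable counting the number of ordered pairs of distinct vertices (v, w) such that lk(v) ⊆ st(w). Then the expectation of X equals n(n−1)·(1 − p + p²)^{n−2}. -/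
open Finset Filter Topology

attribute [local instance] Classical.propDecidable

/-- `lk(v) ⊆ st(w)`: every vertex adjacent to `v` either equals `w` or is adjacent to `w`. -/
def LinkSubsetStar {V : Type*} (Γ : SimpleGraph V) (v w : V) : Prop :=
  ∀ u : V, Γ.Adj v u → (u = w ∨ Γ.Adj w u)

/-- The number of ordered pairs of distinct vertices `(v,w)` with `lk(v) ⊆ st(w)`. -/
noncomputable def lkStarPairCount (n : ℕ) (Γ : SimpleGraph (Fin n)) : ℤ :=
  ((Finset.univ : Finset (Fin n × Fin n)).filter
    (fun q => q.1 ≠ q.2 ∧ LinkSubsetStar Γ q.1 q.2)).card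

/-- If coordinates of a Boolean vector are paired up by `a` and `b`, the sum of a product weight
times a function of the pairs factors over the pairs. -/
theorem sum_prod_mul_prod_pairs {E U : Type*} [Fintype E] [DecidableEq E] [Fintype U] (a b : U → E)
    (hab : Function.Injective (Sum.elim a b)) (g : Bool → ℝ) (hg : ∑ x, g x = 1)
    (c : Bool → Bool → ℝ) :
    ∑ f : E → Bool, (∏ e, g (f e)) * ∏ u, c (f (a u)) (f (b u)) =
      (∑ q : Bool × Bool, g q.1 * g q.2 * c q.1 q.2) ^ Fintype.card U := by
  let R := {e : E // e ∉ Set.range (Sum.elim a b)}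
  let ε : (U ⊕ U) ⊕ R ≃ E :=
    ((Equiv.ofInjective _ hab).sumCongr (Equiv.refl _)).trans
      (Equiv.Set.sumCompl (Set.range (Sum.elim a b)))
  have hεa : ∀ u, ε (Sum.inl (Sum.inl u)) = a u := fun u => rfl
  have hεb : ∀ u, ε (Sum.inl (Sum.inr u)) = b u := fun u => rfl
  let φ : (E → Bool) ≃ (U → Bool × Bool) × (R → Bool) :=
    (Equiv.arrowCongr ε.symm (Equiv.refl Bool)).trans
      ((Equiv.sumArrowEquivProdArrow (U ⊕ U) R Bool).trans
        (((Equiv.sumArrowEquivProdArrow U U Bool).trans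
          (Equiv.arrowProdEquivProdArrow U (fun _ => Bool) (fun _ => Bool)).symm).prodCongr
            (Equiv.refl _)))
  have hφ : ∀ f : E → Bool, (∏ e, g (f e)) * ∏ u, c (f (a u)) (f (b u)) =
      (∏ u, g ((φ f).1 u).1 * g ((φ f).1 u).2 * c ((φ f).1 u).1 ((φ f).1 u).2) *
        ∏ r, g ((φ f).2 r) := by
    intro f
    have h1 : ∀ u, ((φ f).1 u).1 = f (a u) := fun u => rfl
    have h2 : ∀ u, ((φ f).1 u).2 = f (b u) := fun u => rfl
    have h3 : ∀ r, (φ f).2 r = f (ε (Sum.inr r)) := fun r => rfl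
    simp only [h1, h2, h3]
    rw [← ε.prod_comp, Fintype.prod_sum_type, Fintype.prod_sum_type]
    simp only [hεa, hεb, Finset.prod_mul_distrib]
    ring
  rw [Fintype.sum_equiv φ _ (fun q => (∏ u, g (q.1 u).1 * g (q.1 u).2 * c (q.1 u).1 (q.1 u).2) *
        ∏ r, g (q.2 r)) hφ, Fintype.sum_prod_type]
  simp only [← Finset.mul_sum, ← Finset.sum_mul]
  have hR : ∑ x : R → Bool, ∏ r, g (x r) = 1 := by
    rw [← Fintype.piFinset_univ, ← Finset.prod_univ_sum (fun _ => Finset.univ) (fun _ x => g x)]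
    simp only [hg, Finset.prod_const_one]
  have hU : ∑ x : U → Bool × Bool, ∏ u, g (x u).1 * g (x u).2 * c (x u).1 (x u).2 =
      (∑ q : Bool × Bool, g q.1 * g q.2 * c q.1 q.2) ^ Fintype.card U := by
    rw [← Fintype.piFinset_univ, ← Finset.prod_univ_sum (fun _ => Finset.univ)
      (fun _ (q : Bool × Bool) => g q.1 * g q.2 * c q.1 q.2)]
    simp
  rw [hU, hR, mul_one]

/-- A simple graph amounts to the indicator function of its edges among the unordered pairs. -/
noncomputable def simpleGraphEquivBool (V : Type*) :
    SimpleGraph V ≃ ({e : Sym2 V // ¬ e.IsDiag} → Bool) where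
  toFun Γ e := @decide (e.1 ∈ Γ.edgeSet) (Classical.propDecidable _)
  invFun f := SimpleGraph.fromEdgeSet {e | ∃ h : ¬ e.IsDiag, f ⟨e, h⟩ = true}
  left_inv Γ := by
    ext v w
    simp only [SimpleGraph.fromEdgeSet_adj, Set.mem_ofPred_eq, decide_eq_true_eq,
      SimpleGraph.mem_edgeSet, Sym2.mk_isDiag_iff]
    exact ⟨fun h => h.1.2, fun h => ⟨⟨h.ne, h⟩, h.ne⟩⟩
  right_inv f := by
    funext ⟨e, he⟩
    rw [Bool.eq_iff_iff]
    refine (@decide_eq_true_iff _ (Classical.propDecidable _)).trans ?_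
    rw [SimpleGraph.edgeSet_fromEdgeSet]
    simp [he]

theorem simpleGraphEquivBool_apply_eq_true {V : Type*} (Γ : SimpleGraph V)
    (e : {e : Sym2 V // ¬ e.IsDiag}) :
    simpleGraphEquivBool V Γ e = true ↔ e.1 ∈ Γ.edgeSet :=
  @decide_eq_true_iff _ (Classical.propDecidable _)

theorem gnpWeight_eq_prod (n : ℕ) (p : ℝ) (Γ : SimpleGraph (Fin n)) :
    gnpWeight n p Γ =
      ∏ e, (if simpleGraphEquivBool (Fin n) Γ e = true then p else 1 - p) := by
  have hcard : Γ.edgeSet.ncard =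
      (univ.filter fun e => simpleGraphEquivBool (Fin n) Γ e = true).card := by
    rw [← Set.ncard_coe_finset, ← Set.ncard_image_of_injective _ Subtype.val_injective]
    congr 1
    ext e
    simp only [simpleGraphEquivBool_apply_eq_true, Finset.coe_filter,
      Finset.mem_univ, true_and, Set.mem_image, Set.mem_ofPred_eq, Subtype.exists]
    exact ⟨fun h => ⟨e, Γ.not_isDiag_of_mem_edgeSet h, h, rfl⟩, by rintro ⟨_, _, h, rfl⟩; exact h⟩
  have htot : Fintype.card {e : Sym2 (Fin n) // ¬ e.IsDiag} = n.choose 2 := by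
    have h := Sym2.card_subtype_not_diag (α := Fin n)
    rw [Fintype.card_fin] at h
    rw [← h]
  rw [Finset.prod_ite, Finset.prod_const, Finset.prod_const, Finset.filter_not,
    Finset.card_sdiff_of_subset (Finset.filter_subset _ _), Finset.card_univ, htot, ← hcard,
    gnpWeight]

/-- The probability that `lk(v) ⊆ st(w)` for fixed distinct `v` and `w`. -/
theorem gnpProb_linkSubsetStar (n : ℕ) (p : ℝ) {v w : Fin n} (hvw : v ≠ w) :
    gnpProb n p (fun Γ => LinkSubsetStar Γ v w) = (1 - p + p ^ 2) ^ (n - 2) := by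
  let U := {u : Fin n // u ∈ ({v, w} : Finset (Fin n))ᶜ}
  have hU : Fintype.card U = n - 2 := by
    rw [Fintype.card_coe, Finset.card_compl, Finset.card_pair hvw, Fintype.card_fin]
  have hUv : ∀ u : U, v ≠ u := fun u h => Finset.mem_compl.1 u.2 (by simp [← h])
  have hUw : ∀ u : U, w ≠ u := fun u h => Finset.mem_compl.1 u.2 (by simp [← h])
  let a : U → {e : Sym2 (Fin n) // ¬ e.IsDiag} := fun u => ⟨s(v, u), by simpa using hUv u⟩
  let b : U → {e : Sym2 (Fin n) // ¬ e.IsDiag} := fun u => ⟨s(w, u), by simpa using hUw u⟩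
  have hab : Function.Injective (Sum.elim a b) := by
    have h : ∀ u u', a u ≠ b u' := by
      intro u u' h
      have h := Sym2.eq_iff.1 (congrArg Subtype.val h)
      exact h.elim (fun h => hvw h.1) (fun h => hUv u' h.1)
    refine Function.Injective.sumElim (fun u u' h => ?_) (fun u u' h => ?_) h
    · exact Subtype.ext (Sym2.congr_right.1 (congrArg Subtype.val h))
    · exact Subtype.ext (Sym2.congr_right.1 (congrArg Subtype.val h))
  have key := sum_prod_mul_prod_pairs a b hab (fun x => if x = true then p else 1 - p) (by simp)
    (fun x y => if x = true → y = true then 1 else 0)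
  rw [hU] at key
  have hsum : ∑ q : Bool × Bool, (if q.1 = true then p else 1 - p) *
      (if q.2 = true then p else 1 - p) * (if q.1 = true → q.2 = true then (1 : ℝ) else 0) =
        1 - p + p ^ 2 := by
    simp only [Fintype.sum_prod_type, Fintype.sum_bool]
    simp
    ring
  rw [hsum] at key
  rw [← key, gnpProb]
  refine Fintype.sum_equiv (simpleGraphEquivBool (Fin n)) _ _ fun Γ => ?_
  have hiff : LinkSubsetStar Γ v w ↔ ∀ u : U, simpleGraphEquivBool (Fin n) Γ (a u) = true →
      simpleGraphEquivBool (Fin n) Γ (b u) = true := by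
    simp only [simpleGraphEquivBool_apply_eq_true, a, b,
      SimpleGraph.mem_edgeSet]
    refine ⟨fun h u hu => (h u hu).resolve_left (hUw u).symm, fun h u hu => ?_⟩
    by_cases huw : u = w
    · exact Or.inl huw
    · exact Or.inr (h ⟨u, by simp [huw, hu.ne']⟩ hu)
  rw [gnpWeight_eq_prod, Finset.prod_boole]
  simp only [Finset.mem_univ, true_imp_iff, hiff, mul_ite, mul_one, mul_zero]

/-- The expected number of ordered pairs of distinct vertices `(v,w)` with
`lk(v) ⊆ st(w)` in `G(n,p)` is `n(n-1)(1-p+p²)^{n-2}`. -/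
theorem gnp_exp_lkStarPairCount (n : ℕ) (hn : 2 ≤ n) (p : ℝ) (hp0 : 0 ≤ p) (hp1 : p ≤ 1) :
    gnpExp n p (fun Γ => (lkStarPairCount n Γ : ℝ)) =
      (n : ℝ) * (n - 1) * (1 - p + p ^ 2) ^ (n - 2) := by
  have hexp : gnpExp n p (fun Γ => (lkStarPairCount n Γ : ℝ)) =
      ∑ q ∈ (univ : Finset (Fin n)).offDiag, gnpProb n p (fun Γ => LinkSubsetStar Γ q.1 q.2) := by
    simp only [gnpExp, gnpProb]
    rw [Finset.sum_comm]
    refine Finset.sum_congr rfl fun Γ _ => ?_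
    have hfilter : (univ.filter fun q : Fin n × Fin n => q.1 ≠ q.2 ∧ LinkSubsetStar Γ q.1 q.2) =
        (univ : Finset (Fin n)).offDiag.filter fun q => LinkSubsetStar Γ q.1 q.2 := by
      ext q
      simp
    rw [lkStarPairCount, hfilter, ← Finset.sum_filter, Finset.sum_const, nsmul_eq_mul, mul_comm]
    push_cast
    rfl
  rw [hexp, Finset.sum_congr rfl fun q hq =>
    gnpProb_linkSubsetStar n p (Finset.mem_offDiag.1 hq).2.2, Finset.sum_const,
    Finset.offDiag_card, Finset.card_univ, Fintype.card_fin, nsmul_eq_mul,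
    Nat.cast_sub (Nat.le_mul_self n)]
  push_cast
  ring
end

section
/- Let p : ℕ → ℝ with 0 < p(n) < 1 for all n. If n·p(n)·(1 − p(n)) − 2·log n → ∞ as n → ∞, then n²·(1 − p(n) + p(n)²)^{n−2} → 0 as n → ∞. -/
open Filter Topology

/-- If `n·p(n)·(1-p(n)) - 2·log n → ∞` then `n²·(1-p(n)+p(n)²)^{n-2} → 0`. -/
theorem sq_mul_pow_tendsto_zero (p : ℕ → ℝ) (hp : ∀ n, 0 < p n ∧ p n < 1)
    (h : Tendsto (fun n : ℕ => (n : ℝ) * p n * (1 - p n) - 2 * Real.log n) atTop atTop) :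
    Tendsto (fun n : ℕ => (n : ℝ) ^ 2 * (1 - p n + p n ^ 2) ^ (n - 2)) atTop (nhds 0) := by
  have hlim : Tendsto (fun n : ℕ =>
      Real.exp (1 - ((n : ℝ) * p n * (1 - p n) - 2 * Real.log n))) atTop (nhds 0) :=
    Real.tendsto_exp_atBot.comp (tendsto_atBot_add_const_left _ 1 (tendsto_neg_atTop_atBot.comp h))
  have hbase : ∀ n, 0 ≤ 1 - p n + p n ^ 2 := fun n => by nlinarith [hp n, sq_nonneg (p n)]
  refine squeeze_zero' (Eventually.of_forall fun n =>
    mul_nonneg (sq_nonneg _) (pow_nonneg (hbase n) _)) ?_ hlim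
  filter_upwards [eventually_ge_atTop 2] with n hn
  have hn0 : (0 : ℝ) < n := by exact_mod_cast (by omega : 0 < n)
  have hsq : (n : ℝ) ^ 2 = Real.exp (2 * Real.log n) := by
    rw [two_mul, Real.exp_add, Real.exp_log hn0, sq]
  have hle : 1 - p n + p n ^ 2 ≤ Real.exp (-(p n * (1 - p n))) := by
    linarith [Real.add_one_le_exp (-(p n * (1 - p n)))]
  calc (n : ℝ) ^ 2 * (1 - p n + p n ^ 2) ^ (n - 2)
      ≤ (n : ℝ) ^ 2 * Real.exp (-(p n * (1 - p n))) ^ (n - 2) := by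
        gcongr
        exact hbase n
    _ = Real.exp (2 * Real.log n + ((n : ℝ) - 2) * -(p n * (1 - p n))) := by
        rw [hsq, ← Real.exp_nat_mul, ← Real.exp_add, Nat.cast_sub hn, Nat.cast_ofNat]
    _ ≤ Real.exp (1 - ((n : ℝ) * p n * (1 - p n) - 2 * Real.log n)) := by
        apply Real.exp_le_exp.mpr
        nlinarith [sq_nonneg (2 * p n - 1)]
end

section
/- Fix 0 < p < 1, integers n and 0 ≤ ℓ ≤ n − 3, and set F_ℓ(p) = Σ C(s+t, s)·(1−p)^{st}, where the sum is over all pairs of integers s ≥ 1, t ≥ 1 with s + t = n − 1 − ℓ. Then F_ℓ(p) ≤ 2n·(1−p)^{n−2−ℓ} + (1−p)^{−4}·(2(1−p)²)^{n−1−ℓ}. -/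
open Finset

/-- A non-extreme part `s` of a split of `m` satisfies `s (m - s) ≥ 2 (m - 2)`. -/
lemma two_mul_le_mul_sub_add_four {m s : ℕ} (h2 : 2 ≤ s) (hs : s + 2 ≤ m) :
    2 * m ≤ s * (m - s) + 4 := by
  obtain ⟨t, rfl⟩ := Nat.exists_eq_add_of_le (show s ≤ m by omega)
  have ht : 2 ≤ t := by omega
  rw [Nat.add_sub_cancel_left]
  nlinarith

/-- The extreme parts `s = 1` and `s = m - 1` are split off, all others are bounded uniformly. -/
lemma choose_mul_pow_le {m s : ℕ} {q : ℝ} (hq0 : 0 < q) (hq1 : q ≤ 1) (hs0 : 0 < s)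
    (hsm : s < m) :
    (m.choose s : ℝ) * q ^ (s * (m - s)) ≤
      (if s = 1 then m * q ^ (m - 1) else 0) + (if s = m - 1 then m * q ^ (m - 1) else 0) +
        m.choose s * (q ^ (-4 : ℤ) * q ^ (2 * m)) := by
  have hA : 0 ≤ (m : ℝ) * q ^ (m - 1) := by positivity
  have hB : 0 ≤ (m.choose s : ℝ) * (q ^ (-4 : ℤ) * q ^ (2 * m)) := by positivity
  by_cases h1 : s = 1
  · subst h1
    rw [if_pos rfl, Nat.choose_one_right, one_mul]
    rw [Nat.choose_one_right] at hB
    split_ifs <;> linarith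
  by_cases h2 : s = m - 1
  · have hc : m.choose s = m := by
      rw [← Nat.choose_symm hsm.le, show m - s = 1 by omega, Nat.choose_one_right]
    have he : s * (m - s) = m - 1 := by rw [show m - s = 1 by omega, mul_one, h2]
    rw [if_pos h2, if_neg h1, he]
    rw [hc] at hB ⊢
    linarith
  · rw [if_neg h1, if_neg h2, zero_add, zero_add]
    gcongr
    have h := pow_le_pow_of_le_one hq0.le hq1
      (two_mul_le_mul_sub_add_four (show 2 ≤ s by omega) (show s + 2 ≤ m by omega))
    rw [zpow_neg, inv_mul_eq_div, le_div_iff₀ (by positivity)]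
    rw [pow_add] at h
    exact_mod_cast h

lemma sum_choose_mul_pow_le (m : ℕ) {q : ℝ} (hq0 : 0 < q) (hq1 : q ≤ 1) :
    ∑ s ∈ Ioo 0 m, (m.choose s : ℝ) * q ^ (s * (m - s)) ≤
      2 * m * q ^ (m - 1) + q ^ (-4 : ℤ) * (2 * q ^ 2) ^ m := by
  have hA : 0 ≤ (m : ℝ) * q ^ (m - 1) := by positivity
  have hchoose : ∑ s ∈ Ioo 0 m, (m.choose s : ℝ) ≤ 2 ^ m := by
    calc ∑ s ∈ Ioo 0 m, (m.choose s : ℝ) ≤ ∑ s ∈ range (m + 1), (m.choose s : ℝ) := by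
          refine sum_le_sum_of_subset_of_nonneg (fun s hs => ?_) fun _ _ _ => by positivity
          simp only [mem_Ioo, mem_range] at hs ⊢
          omega
      _ = 2 ^ m := mod_cast Nat.sum_range_choose m
  refine (sum_le_sum fun s hs => choose_mul_pow_le hq0 hq1 (mem_Ioo.1 hs).1
    (mem_Ioo.1 hs).2).trans ?_
  rw [sum_add_distrib, sum_add_distrib, sum_ite_eq', sum_ite_eq', ← sum_mul]
  have hlast := mul_le_mul_of_nonneg_right hchoose
    (show 0 ≤ q ^ (-4 : ℤ) * q ^ (2 * m) by positivity)
  have heq : q ^ (-4 : ℤ) * (2 * q ^ 2) ^ m = 2 ^ m * (q ^ (-4 : ℤ) * q ^ (2 * m)) := by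
    rw [mul_pow, ← pow_mul]
    ring
  rw [heq]
  split_ifs <;> linarith

/-- The estimate `F_ℓ(p) ≤ 2n(1-p)^{n-2-ℓ} + (1-p)^{-4}(2(1-p)²)^{n-1-ℓ}` where
`F_ℓ(p) = Σ_{s+t=n-1-ℓ, s,t ≥ 1} C(s+t,s)(1-p)^{st}`. -/
theorem F_ell_bound (n ℓ : ℕ) (hℓ : ℓ + 3 ≤ n) (p : ℝ) (hp0 : 0 < p) (hp1 : p < 1) :
    ∑ s ∈ Finset.Ioo 0 (n - 1 - ℓ),
        ((n - 1 - ℓ).choose s : ℝ) * (1 - p) ^ (s * (n - 1 - ℓ - s)) ≤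
      2 * n * (1 - p) ^ (n - 2 - ℓ) + (1 - p) ^ (-4 : ℤ) * (2 * (1 - p) ^ 2) ^ (n - 1 - ℓ) := by
  have hq0 : 0 < 1 - p := by linarith
  refine (sum_choose_mul_pow_le (n - 1 - ℓ) hq0 (by linarith)).trans ?_
  rw [show n - 1 - ℓ - 1 = n - 2 - ℓ by omega]
  gcongr
  omega
end
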